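/- Suppose α, β > 0, α(‖P‖ + β‖H‖²) < 1, and ρ ∈ (0, 2), and let (z^j, w^j, ξ^j, η^j) be the xPIPG iterates from arbitrary initial points ξ¹ ∈ ℝ^n, η¹ ∈ ℝ^m. Then there exist z̄ ∈ rec D and w̄ ∈ K° such that lim_{j→∞} (z^{j+1} − z^j) = z̄, lim_{j→∞} (w^{j+1} − w^j) = w̄, lim_{j→∞} z^j / j = z̄, and lim_{j→∞} w^j / j = w̄. -/

import Mathlib

open scoped RealInnerProductSpace
open Filter Topology Matrix

/-- Spectral norm (largest singular value) of a real matrix. -/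
noncomputable def specNorm {ι κ : Type*} [Fintype ι] [Fintype κ] [DecidableEq κ]
    (A : Matrix ι κ ℝ) : ℝ :=
  ‖LinearMap.toContinuousLinearMap (Matrix.toEuclideanLin A)‖

/-- The linear map on Euclidean space induced by a matrix (matrix-vector product). -/
noncomputable def mvec {ι κ : Type*} [Fintype ι] [Fintype κ] [DecidableEq κ]
    (A : Matrix ι κ ℝ) (x : EuclideanSpace ℝ κ) : EuclideanSpace ℝ ι :=
  Matrix.toEuclideanLin A x

open Classical in
/-- Projection onto a (nonempty closed convex) set: the minimizer of the distance to `x`. -/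
noncomputable def proj {ι : Type*} [Fintype ι] (C : Set (EuclideanSpace ℝ ι))
    (x : EuclideanSpace ℝ ι) : EuclideanSpace ℝ ι :=
  if h : ∃ y ∈ C, ∀ c ∈ C, ‖x - y‖ ≤ ‖x - c‖ then h.choose else x

/-- Polar cone `K° = {w | ⟨w, y⟩ ≤ 0 for all y ∈ K}`. -/
def polarCone {ι : Type*} [Fintype ι] (K : Set (EuclideanSpace ℝ ι)) :
    Set (EuclideanSpace ℝ ι) := {w | ∀ y ∈ K, ⟪w, y⟫ ≤ 0}

/-- Recession cone `rec D = {y | y + z ∈ D for all z ∈ D}`. -/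
def recCone {ι : Type*} [Fintype ι] (D : Set (EuclideanSpace ℝ ι)) :
    Set (EuclideanSpace ℝ ι) := {y | ∀ z ∈ D, y + z ∈ D}

/-- Normal cone of `C` at `x`: `N_C(x) = {y | ⟨y, x' − x⟩ ≤ 0 for all x' ∈ C}`. -/
def normalCone {ι : Type*} [Fintype ι] (C : Set (EuclideanSpace ℝ ι))
    (x : EuclideanSpace ℝ ι) : Set (EuclideanSpace ℝ ι) :=
  {y | ∀ x' ∈ C, ⟪y, x' - x⟫ ≤ 0}

/-- A closed convex cone. -/
def IsClosedConvexCone {ι : Type*} [Fintype ι] (K : Set (EuclideanSpace ℝ ι)) : Prop :=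
  IsClosed K ∧ Convex ℝ K ∧ ∀ w ∈ K, ∀ c : ℝ, 0 ≤ c → c • w ∈ K

/-- Support function of `D`, valued in `EReal`: `σ_D(x) = sup_{y ∈ D} ⟨y, x⟩`. -/
noncomputable def supportF {ι : Type*} [Fintype ι] (D : Set (EuclideanSpace ℝ ι))
    (x : EuclideanSpace ℝ ι) : EReal :=
  ⨆ y : D, ((⟪(y : EuclideanSpace ℝ ι), x⟫ : ℝ) : EReal)

theorem exists_tendsto_sub_of_averaged {E : Type*} [NormedAddCommGroup E] [InnerProductSpace ℝ E]
    [CompleteSpace E] (u : ℕ → E) {a : ℝ} (ha : 1 / 2 < a)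
    (h : ∀ n m, ⟪(u (n + 1) - u n) - (u (m + 1) - u m), u n - u m⟫ ≤
      -a * ‖(u (n + 1) - u n) - (u (m + 1) - u m)‖ ^ 2) :
    ∃ d, Tendsto (fun n => u (n + 1) - u n) atTop (𝓝 d) := by
  set d : ℕ → E := fun n => u (n + 1) - u n with hd
  have hsq : ∀ n m, ‖u (n + 1) - u (m + 1)‖ ^ 2 ≤
      ‖u n - u m‖ ^ 2 - (2 * a - 1) * ‖d n - d m‖ ^ 2 := by
    intro n m
    have e : u (n + 1) - u (m + 1) = (u n - u m) + (d n - d m) := by simp only [hd]; abel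
    have h1 : ⟪d n - d m, u n - u m⟫ ≤ -a * ‖d n - d m‖ ^ 2 := h n m
    rw [e, norm_add_sq_real, real_inner_comm]
    linarith
  have hne : ∀ n m, ‖u (n + 1) - u (m + 1)‖ ≤ ‖u n - u m‖ := by
    intro n m
    refine pow_le_pow_iff_left₀ (norm_nonneg _) (norm_nonneg _) two_ne_zero |>.1 ?_
    nlinarith [hsq n m, sq_nonneg ‖d n - d m‖]
  have hanti : Antitone fun n => ‖d n‖ := antitone_nat_of_succ_le fun n => hne (n + 1) n
  have hbdd : BddBelow (Set.range fun n => ‖d n‖) := ⟨0, by rintro _ ⟨n, rfl⟩; positivity⟩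
  obtain ⟨r, hr⟩ : ∃ r, Tendsto (fun n => ‖d n‖) atTop (𝓝 r) :=
    ⟨_, tendsto_atTop_ciInf hanti hbdd⟩
  have hr0 : 0 ≤ r := ge_of_tendsto' hr fun n => norm_nonneg _
  have hdd : Tendsto (fun n => d (n + 1) - d n) atTop (𝓝 0) := by
    have h1 : Tendsto (fun n => (‖d n‖ ^ 2 - ‖d (n + 1)‖ ^ 2) / (2 * a - 1)) atTop (𝓝 0) := by
      simpa using ((hr.pow 2).sub ((hr.comp (tendsto_add_atTop_nat 1)).pow 2)).div_const (2 * a - 1)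
    have h2 : Tendsto (fun n => ‖d (n + 1) - d n‖ ^ 2) atTop (𝓝 0) := by
      refine squeeze_zero (fun n => by positivity) (fun n => ?_) h1
      rw [le_div_iff₀ (by linarith)]
      have := hsq (n + 1) n
      simp only [hd] at this ⊢
      linarith
    rw [tendsto_zero_iff_norm_tendsto_zero]
    simpa using h2.sqrt
  have hdk : ∀ k, Tendsto (fun n => d (n + k) - d n) atTop (𝓝 0) := by
    intro k
    induction k with
    | zero => simp
    | succ k ih =>
      have := (hdd.comp (tendsto_add_atTop_nat k)).add ih
      simp only [add_zero] at this
      refine this.congr fun n => ?_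
      simp [← add_assoc]
  have huk : ∀ k : ℕ, Tendsto (fun n => u (n + k) - u n - (k : ℝ) • d n) atTop (𝓝 0) := by
    intro k
    induction k with
    | zero => simp
    | succ k ih =>
      have := ih.add (hdk k)
      simp only [add_zero] at this
      refine this.congr fun n => ?_
      simp only [hd, ← add_assoc, Nat.cast_succ, add_smul, one_smul]
      abel
  have hlow : ∀ n k : ℕ, k * r ≤ ‖u (n + k) - u n‖ := by
    intro n k
    have h1 : Antitone fun n => ‖u (n + k) - u n‖ := antitone_nat_of_succ_le fun n => by
      simpa [add_right_comm] using hne (n + k) n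
    have h2 : Tendsto (fun n => ‖u (n + k) - u n‖) atTop (𝓝 (k * r)) := by
      have h3 : Tendsto (fun n => ‖(k : ℝ) • d n‖) atTop (𝓝 (k * r)) := by
        simpa [norm_smul] using hr.const_mul (k : ℝ)
      refine tendsto_of_tendsto_of_dist h3 ?_
      refine squeeze_zero (fun _ => dist_nonneg) (fun n => ?_)
        (tendsto_zero_iff_norm_tendsto_zero.1 (huk k))
      rw [dist_comm, Real.dist_eq]
      exact abs_norm_sub_norm_le _ _
    exact h1.le_of_tendsto h2 n
  have hupp : ∀ n k : ℕ, ‖u (n + k) - u n‖ ≤ k * ‖d n‖ := by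
    intro n k
    induction k with
    | zero => simp
    | succ k ih =>
      have h1 : ‖d (n + k)‖ ≤ ‖d n‖ := hanti (Nat.le_add_right _ _)
      have e : u (n + (k + 1)) - u n = (u (n + k) - u n) + d (n + k) := by
        simp only [hd, ← add_assoc]; abel
      rw [e]
      push_cast
      linarith [norm_add_le (u (n + k) - u n) (d (n + k))]
  have hd0 : ∀ n, ‖d n‖ ≤ ‖d 0‖ := fun n => hanti (Nat.zero_le n)
  have hmid : ∀ p q, 2 * r ≤ ‖d p + d q‖ := by
    intro p q
    have hM : ∀ M, 2 * r ^ 2 ≤ ‖d p + d q‖ * ‖d M‖ := by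
      intro M
      have hstep : ∀ s N, ⟪d (M + N), u (M + N) - u M⟫ ≤
          ⟪d s, u (M + N) - u M⟫ + 2 * ‖d 0‖ * ‖u M - u s‖ := by
        intro s N
        have h1 : ⟪d (M + N) - d s, u (M + N) - u s⟫ ≤ 0 :=
          (h (M + N) s).trans (by nlinarith [sq_nonneg ‖d (M + N) - d s‖])
        have h2 : u (M + N) - u s = (u (M + N) - u M) + (u M - u s) := by abel
        rw [h2, inner_add_right, inner_sub_left] at h1
        have h3 := neg_le_of_abs_le (abs_real_inner_le_norm (d (M + N) - d s) (u M - u s))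
        have h4 : ‖d (M + N) - d s‖ ≤ 2 * ‖d 0‖ :=
          (norm_sub_le _ _).trans (by linarith [hd0 (M + N), hd0 s])
        have h5 := mul_le_mul_of_nonneg_right h4 (norm_nonneg (u M - u s))
        linarith
      obtain ⟨C, hC⟩ : ∃ C, ∀ N : ℕ, 2 * ⟪d (M + N), u (M + N) - u M⟫ + ‖d (M + N)‖ ^ 2 ≤
          ‖d p + d q‖ * ‖d M‖ * N + C := by
        refine ⟨2 * ‖d 0‖ * ‖u M - u p‖ + 2 * ‖d 0‖ * ‖u M - u q‖ + ‖d 0‖ ^ 2, fun N => ?_⟩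
        have h1 := real_inner_le_norm (d p + d q) (u (M + N) - u M)
        have h2 := mul_le_mul_of_nonneg_left (hupp M N) (norm_nonneg (d p + d q))
        have h3 := pow_le_pow_left₀ (norm_nonneg _) (hd0 (M + N)) 2
        rw [inner_add_left] at h1
        linarith [hstep p N, hstep q N]
      have hb : ∀ N : ℕ, 2 * ‖u (M + N) - u M‖ ^ 2 ≤
          ‖d p + d q‖ * ‖d M‖ * N ^ 2 + 2 * C * N := by
        intro N
        induction N with
        | zero => simp
        | succ N ih =>
          have e : u (M + (N + 1)) - u M = d (M + N) + (u (M + N) - u M) := by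
            simp only [hd, ← add_assoc]; abel
          rw [e, norm_add_sq_real]
          push_cast
          have : 0 ≤ ‖d p + d q‖ * ‖d M‖ := by positivity
          linarith [hC N]
      have hlim : Tendsto (fun N : ℕ => ‖d p + d q‖ * ‖d M‖ + 2 * C * (1 / ((N : ℝ) + 1))) atTop
          (𝓝 (‖d p + d q‖ * ‖d M‖)) := by
        simpa using (tendsto_one_div_add_atTop_nhds_zero_nat.const_mul (2 * C)).const_add
          (‖d p + d q‖ * ‖d M‖)
      refine ge_of_tendsto' hlim fun N => ?_
      have h1 := hb (N + 1)
      have h2 := pow_le_pow_left₀ (mul_nonneg (Nat.cast_nonneg _) hr0) (hlow M (N + 1)) 2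
      push_cast at h1 h2
      have h3 : (0 : ℝ) < N + 1 := by positivity
      have h4 : 2 * r ^ 2 * ((N : ℝ) + 1) ^ 2 ≤
          (‖d p + d q‖ * ‖d M‖ + 2 * C * (1 / ((N : ℝ) + 1))) * ((N : ℝ) + 1) ^ 2 := by
        have : (‖d p + d q‖ * ‖d M‖ + 2 * C * (1 / ((N : ℝ) + 1))) * ((N : ℝ) + 1) ^ 2 =
          ‖d p + d q‖ * ‖d M‖ * ((N : ℝ) + 1) ^ 2 + 2 * C * (N + 1) := by field_simp
        rw [this]; linarith
      exact le_of_mul_le_mul_right h4 (by positivity)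
    have hlim := ge_of_tendsto' (hr.const_mul ‖d p + d q‖) hM
    rcases hr0.eq_or_lt with h0 | h0
    · rw [← h0]; simp
    · exact le_of_mul_le_mul_right (by linarith) h0
  have hcau : CauchySeq d := by
    refine cauchySeq_of_le_tendsto_0 (fun N => √(4 * (‖d N‖ ^ 2 - r ^ 2))) (fun p q N hp hq => ?_) ?_
    · rw [dist_eq_norm]
      apply Real.le_sqrt_of_sq_le
      have h1 := parallelogram_law_with_norm ℝ (d p) (d q)
      have h2 := pow_le_pow_left₀ (by positivity) (hmid p q) 2
      have h3 := pow_le_pow_left₀ (norm_nonneg _) (hanti hp) 2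
      have h4 := pow_le_pow_left₀ (norm_nonneg _) (hanti hq) 2
      simp only at h3 h4
      linarith
    · have := (((hr.pow 2).sub_const (r ^ 2)).const_mul 4).sqrt
      rwa [sub_self, mul_zero, Real.sqrt_zero] at this
  exact cauchySeq_tendsto_of_complete hcau

theorem tendsto_inv_smul_of_tendsto_sub {E : Type*} [NormedAddCommGroup E] [NormedSpace ℝ E]
    {u : ℕ → E} {d : E} (h : Tendsto (fun n => u (n + 1) - u n) atTop (𝓝 d)) :
    Tendsto (fun n : ℕ => (n : ℝ)⁻¹ • u n) atTop (𝓝 d) := by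
  have h1 : Tendsto (fun n : ℕ => (n : ℝ)⁻¹ • u 0) atTop (𝓝 0) := by
    simpa using (tendsto_inv_atTop_nhds_zero_nat (𝕜 := ℝ)).smul_const (u 0)
  have h2 := h.cesaro_smul.add h1
  rw [add_zero] at h2
  refine h2.congr fun n => ?_
  rw [Finset.sum_range_sub, ← smul_add, sub_add_cancel]

theorem proj_spec {ι : Type*} [Fintype ι] {C : Set (EuclideanSpace ℝ ι)} (hne : C.Nonempty)
    (hcl : IsClosed C) (hcv : Convex ℝ C) (x : EuclideanSpace ℝ ι) :
    proj C x ∈ C ∧ ∀ c ∈ C, ⟪x - proj C x, c - proj C x⟫ ≤ 0 := by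
  have hex : ∃ y ∈ C, ∀ c ∈ C, ‖x - y‖ ≤ ‖x - c‖ := by
    obtain ⟨y, hy, hxy⟩ := hcl.exists_infDist_eq_dist hne x
    refine ⟨y, hy, fun c hc => ?_⟩
    rw [← dist_eq_norm, ← dist_eq_norm, ← hxy]
    exact Metric.infDist_le_dist_of_mem hc
  have hp : proj C x = hex.choose := by simp only [proj, dif_pos hex]
  obtain ⟨hmem, hmin⟩ := hex.choose_spec
  rw [← hp] at hmem hmin
  refine ⟨hmem, (norm_eq_iInf_iff_real_inner_le_zero hcv hmem).1 (le_antisymm ?_ ?_)⟩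
  · have : Nonempty C := hne.to_subtype
    exact le_ciInf fun c => hmin c c.2
  · exact ciInf_le ⟨0, by rintro _ ⟨c, rfl⟩; positivity⟩ (⟨_, hmem⟩ : C)

/-- The projection onto a closed convex set is firmly nonexpansive. -/
theorem inner_proj_sub_proj_nonneg {ι : Type*} [Fintype ι] {C : Set (EuclideanSpace ℝ ι)}
    (hne : C.Nonempty) (hcl : IsClosed C) (hcv : Convex ℝ C) (x y : EuclideanSpace ℝ ι) :
    0 ≤ ⟪(x - y) - (proj C x - proj C y), proj C x - proj C y⟫ := by
  have h1 := (proj_spec hne hcl hcv x).2 _ (proj_spec hne hcl hcv y).1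
  have h2 := (proj_spec hne hcl hcv y).2 _ (proj_spec hne hcl hcv x).1
  rw [← neg_sub (proj C x) (proj C y), inner_neg_right] at h1
  have e : (x - y) - (proj C x - proj C y) = (x - proj C x) - (y - proj C y) := by abel
  rw [e, inner_sub_left]
  linarith

theorem zero_mem_polarCone {ι : Type*} [Fintype ι] (K : Set (EuclideanSpace ℝ ι)) :
    (0 : EuclideanSpace ℝ ι) ∈ polarCone K := fun y _ => by simp

theorem isClosed_polarCone {ι : Type*} [Fintype ι] (K : Set (EuclideanSpace ℝ ι)) :
    IsClosed (polarCone K) := by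
  simp only [polarCone, Set.ofPred_forall]
  exact isClosed_iInter fun y => isClosed_iInter fun _ =>
    isClosed_le (by fun_prop) continuous_const

theorem smul_mem_polarCone {ι : Type*} [Fintype ι] {K : Set (EuclideanSpace ℝ ι)}
    {w : EuclideanSpace ℝ ι} (hw : w ∈ polarCone K) {c : ℝ} (hc : 0 ≤ c) :
    c • w ∈ polarCone K := fun y hy => by
  rw [real_inner_smul_left]
  exact mul_nonpos_of_nonneg_of_nonpos hc (hw y hy)

theorem convex_polarCone {ι : Type*} [Fintype ι] (K : Set (EuclideanSpace ℝ ι)) :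
    Convex ℝ (polarCone K) := by
  intro x hx y hy a b ha hb _ k hk
  have h1 := smul_mem_polarCone hx ha k hk
  have h2 := smul_mem_polarCone hy hb k hk
  rw [inner_add_left]
  linarith

theorem mem_recCone_of_tendsto {ι : Type*} [Fintype ι] {D : Set (EuclideanSpace ℝ ι)}
    (hcl : IsClosed D) (hcv : Convex ℝ D) {z : ℕ → EuclideanSpace ℝ ι}
    (hz : ∀ᶠ j in atTop, z j ∈ D) {d : EuclideanSpace ℝ ι}
    (h : Tendsto (fun j : ℕ => (j : ℝ)⁻¹ • z j) atTop (𝓝 d)) : d ∈ recCone D := by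
  intro x hx
  have h1 : Tendsto (fun j : ℕ => (j : ℝ)⁻¹ • z j + (1 - (j : ℝ)⁻¹) • x) atTop (𝓝 (d + x)) := by
    simpa using h.add (((tendsto_inv_atTop_nhds_zero_nat (𝕜 := ℝ)).const_sub 1).smul_const x)
  refine hcl.mem_of_tendsto h1 ?_
  filter_upwards [hz, eventually_ge_atTop 1] with j hj hj1
  have hj' : (1 : ℝ) ≤ j := by exact_mod_cast hj1
  exact hcv hj hx (by positivity) (sub_nonneg.2 (inv_le_one_of_one_le₀ hj')) (by ring)

open scoped MatrixOrder in
theorem exists_inner_eq_inner_of_isPositive {ι : Type*} [Fintype ι] [DecidableEq ι]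
    {Q : EuclideanSpace ℝ ι →ₗ[ℝ] EuclideanSpace ℝ ι} (hQ : Q.IsPositive) :
    ∃ B : EuclideanSpace ℝ ι →ₗ[ℝ] EuclideanSpace ℝ ι, ∀ x y, ⟪B x, B y⟫ = ⟪Q x, y⟫ := by
  obtain ⟨A, rfl⟩ := (Matrix.toEuclideanLin (𝕜 := ℝ) (m := ι) (n := ι)).surjective Q
  have hA := Matrix.nonneg_iff_posSemidef.2 (Matrix.isPositive_toEuclideanLin_iff.1 hQ)
  obtain ⟨B, rfl⟩ := CStarAlgebra.nonneg_iff_eq_star_mul_self.1 hA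
  refine ⟨Matrix.toEuclideanLin B, fun x y => ?_⟩
  have h : Matrix.toEuclideanLin (star B * B) x =
      LinearMap.adjoint (Matrix.toEuclideanLin B) (Matrix.toEuclideanLin B x) := by
    rw [← Matrix.toEuclideanLin_conjTranspose_eq_adjoint, ← Matrix.star_eq_conjTranspose]
    simp [Matrix.toLpLin_apply, Matrix.mulVec_mulVec]
  rw [h, LinearMap.adjoint_inner_left]

/-- The preconditioning quadratic form of the primal-dual iteration is the square of the norm
of an injective linear map. -/
theorem exists_preconditioner_factorization {ι κ : Type*} [Fintype ι] [DecidableEq ι] [Fintype κ]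
    {P : EuclideanSpace ℝ ι →ₗ[ℝ] EuclideanSpace ℝ ι} (hP : P.IsPositive)
    (H : EuclideanSpace ℝ ι →ₗ[ℝ] EuclideanSpace ℝ κ) {α β : ℝ} (hα : 0 < α) (hβ : 0 < β)
    (hstep : α * (‖LinearMap.toContinuousLinearMap P‖ +
      β * ‖LinearMap.toContinuousLinearMap H‖ ^ 2) < 1) :
    ∃ L : EuclideanSpace ℝ ι × EuclideanSpace ℝ κ →ₗ[ℝ]
        WithLp 2 (EuclideanSpace ℝ ι × EuclideanSpace ℝ κ),
      LinearMap.ker L = ⊥ ∧ ∀ u v, ⟪L u, L v⟫ = α⁻¹ * ⟪u.1, v.1⟫ - ⟪P u.1, v.1⟫ -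
        ⟪H u.1, v.2⟫ - ⟪H v.1, u.2⟫ + β⁻¹ * ⟪u.2, v.2⟫ := by
  set p := ‖LinearMap.toContinuousLinearMap P‖
  set r := ‖LinearMap.toContinuousLinearMap H‖
  have hgap : 0 < α⁻¹ - p - β * r ^ 2 := by
    have : p + β * r ^ 2 < α⁻¹ := by
      rw [← one_div, lt_div_iff₀ hα]; linarith
    linarith
  set Q : EuclideanSpace ℝ ι →ₗ[ℝ] EuclideanSpace ℝ ι :=
    α⁻¹ • LinearMap.id - P - β • (LinearMap.adjoint H ∘ₗ H) with hQdef
  have hQ : ∀ x y, ⟪Q x, y⟫ = α⁻¹ * ⟪x, y⟫ - ⟪P x, y⟫ - β * ⟪H x, H y⟫ := by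
    intro x y
    simp [hQdef, inner_sub_left, real_inner_smul_left, LinearMap.adjoint_inner_left]
  have hQlow : ∀ x, (α⁻¹ - p - β * r ^ 2) * ‖x‖ ^ 2 ≤ ⟪Q x, x⟫ := by
    intro x
    rw [hQ, real_inner_self_eq_norm_sq, real_inner_self_eq_norm_sq]
    have h1 : ‖P x‖ ≤ p * ‖x‖ := (LinearMap.toContinuousLinearMap P).le_opNorm x
    have h2 : ‖H x‖ ≤ r * ‖x‖ := (LinearMap.toContinuousLinearMap H).le_opNorm x
    have h3 := real_inner_le_norm (P x) x
    have h4 := mul_le_mul_of_nonneg_right h1 (norm_nonneg x)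
    have h5 := mul_le_mul_of_nonneg_left (pow_le_pow_left₀ (norm_nonneg _) h2 2) hβ.le
    linarith
  have hQpos : Q.IsPositive := by
    refine ⟨fun x y => ?_, fun x => ?_⟩
    · rw [hQ, ← real_inner_comm x (Q y), hQ, real_inner_comm y x, real_inner_comm (H y) (H x),
        hP.1 x y, real_inner_comm (P y) x]
    · exact (mul_nonneg hgap.le (sq_nonneg _)).trans (hQlow x)
  obtain ⟨B, hB⟩ := exists_inner_eq_inner_of_isPositive hQpos
  have hs : (√β)⁻¹ * (√β)⁻¹ = β⁻¹ := by rw [← mul_inv, Real.mul_self_sqrt hβ.le]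
  refine ⟨(WithLp.linearEquiv 2 ℝ _).symm.toLinearMap ∘ₗ (B ∘ₗ LinearMap.fst ℝ _ _).prod
    ((√β)⁻¹ • (LinearMap.snd ℝ _ _ - β • (H ∘ₗ LinearMap.fst ℝ _ _))), ?_, fun u v => ?_⟩
  · rw [LinearMap.ker_eq_bot']
    rintro ⟨x, y⟩ hxy
    have hxy' := congrArg (WithLp.linearEquiv 2 ℝ _) hxy
    simp only [LinearMap.comp_apply, LinearEquiv.coe_coe, LinearEquiv.apply_symm_apply, map_zero,
      LinearMap.prod_apply, Function.prod_apply, Prod.mk_eq_zero, LinearMap.fst_apply,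
      LinearMap.snd_apply, LinearMap.smul_apply, LinearMap.sub_apply, smul_eq_zero, inv_eq_zero,
      (Real.sqrt_pos.2 hβ).ne', false_or] at hxy'
    have hx : x = 0 := by
      have h1 := hQlow x
      rw [← hB, hxy'.1, inner_zero_left] at h1
      have h2 : ‖x‖ ^ 2 ≤ 0 := by
        by_contra! h
        exact absurd h1 (not_le.2 (mul_pos hgap h))
      simpa using le_antisymm h2 (sq_nonneg _)
    have hy := hxy'.2
    rw [hx, map_zero, smul_zero, sub_zero] at hy
    simp [hx, hy]
  · simp only [WithLp.prod_inner_apply, LinearMap.comp_apply, LinearEquiv.coe_coe,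
      WithLp.coe_symm_linearEquiv, LinearMap.prod_apply, Function.prod_apply, hB, hQ,
      LinearMap.fst_apply, LinearMap.snd_apply, LinearMap.smul_apply, LinearMap.sub_apply,
      real_inner_smul_left, real_inner_smul_right, inner_sub_left, inner_sub_right]
    rw [← real_inner_comm (H v.1) u.2]
    linear_combination (⟪u.2, v.2⟫ - β * ⟪u.2, H v.1⟫ - β * ⟪H u.1, v.2⟫ +
      β ^ 2 * ⟪H u.1, H v.1⟫) * hs + (β * ⟪H u.1, H v.1⟫ - ⟪u.2, H v.1⟫ - ⟪H u.1, v.2⟫) *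
        inv_mul_cancel₀ hβ.ne'

theorem exists_tendsto_sub_of_relaxed_proximal {E F : Type*} [NormedAddCommGroup E]
    [NormedSpace ℝ E] [FiniteDimensional ℝ E] [NormedAddCommGroup F] [InnerProductSpace ℝ F]
    [CompleteSpace F] (L : E →ₗ[ℝ] F) (hL : LinearMap.ker L = ⊥) {ρ : ℝ} (hρ : ρ ∈ Set.Ioo (0 : ℝ) 2)
    {u v : ℕ → E} (hu : ∀ n, u (n + 1) = (1 - ρ) • u n + ρ • v n)
    (hmono : ∀ n m, 0 ≤ ⟪L ((u n - u m) - (v n - v m)), L (v n - v m)⟫) :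
    ∃ d, Tendsto (fun n => v (n + 1) - v n) atTop (𝓝 d) := by
  have hρ0 : ρ ≠ 0 := hρ.1.ne'
  have hv : ∀ n, v n = u n + ρ⁻¹ • (u (n + 1) - u n) := by
    intro n
    have : u (n + 1) - u n = ρ • (v n - u n) := by rw [hu]; module
    rw [this, inv_smul_smul₀ hρ0]; abel
  obtain ⟨e, he⟩ := exists_tendsto_sub_of_averaged (fun n => L (u n)) (a := ρ⁻¹)
    (by rw [one_div]; exact inv_strictAnti₀ hρ.1 hρ.2) (fun n m => by
      have h := hmono n m
      set δ := (u (n + 1) - u n) - (u (m + 1) - u m) with hδ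
      have e1 : v n - v m = (u n - u m) + ρ⁻¹ • δ := by rw [hv n, hv m, hδ]; module
      have e2 : L (u (n + 1)) - L (u n) - (L (u (m + 1)) - L (u m)) = L δ := by simp [hδ]
      rw [e1, sub_add_cancel_left, map_neg, map_add, map_smul, inner_neg_left, inner_add_right,
        real_inner_smul_left, real_inner_smul_left, real_inner_smul_right,
        real_inner_self_eq_norm_sq] at h
      rw [e2, ← map_sub]
      have h' : 0 ≤ ρ⁻¹ * (-⟪L δ, L (u n - u m)⟫ - ρ⁻¹ * ‖L δ‖ ^ 2) := by linarith
      linarith [nonneg_of_mul_nonneg_right h' (inv_pos.2 hρ.1)])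
  have hemb := LinearMap.isClosedEmbedding_of_injective hL
  simp only [← map_sub] at he
  obtain ⟨d, rfl⟩ : e ∈ Set.range L :=
    hemb.isClosed_range.mem_of_tendsto he (Eventually.of_forall fun n => ⟨_, rfl⟩)
  have hd : Tendsto (fun n => u (n + 1) - u n) atTop (𝓝 d) := hemb.tendsto_nhds_iff.2 he
  refine ⟨d, ?_⟩
  have h1 := hd.add (((hd.comp (tendsto_add_atTop_nat 1)).sub hd).const_smul ρ⁻¹)
  rw [sub_self, smul_zero, add_zero] at h1
  refine h1.congr fun n => ?_
  rw [hv (n + 1), hv n]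
  simp only [Function.comp_apply]
  module

theorem mvec_inner_transpose {ι κ : Type*} [Fintype ι] [DecidableEq ι] [Fintype κ] [DecidableEq κ]
    (A : Matrix ι κ ℝ) (y : EuclideanSpace ℝ ι) (x : EuclideanSpace ℝ κ) :
    ⟪Matrix.toEuclideanLin Aᵀ y, x⟫ = ⟪Matrix.toEuclideanLin A x, y⟫ := by
  rw [← Matrix.conjTranspose_eq_transpose_of_trivial, Matrix.toEuclideanLin_conjTranspose_eq_adjoint,
    LinearMap.adjoint_inner_left, real_inner_comm]

theorem primal_dual_step_monotone {E F : Type*} [NormedAddCommGroup E] [InnerProductSpace ℝ E]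
    [NormedAddCommGroup F] [InnerProductSpace ℝ F] {P : E →ₗ[ℝ] E} {H : E →ₗ[ℝ] F}
    {G : F →ₗ[ℝ] E} (hP : ∀ x, 0 ≤ ⟪P x, x⟫) (hG : ∀ y x, ⟪G y, x⟫ = ⟪H x, y⟫)
    {α β : ℝ} (hα : 0 < α) (hβ : 0 < β) {x z : E} {y w : F}
    (hz : 0 ≤ ⟪x - α • (P x + G y) - z, z⟫)
    (hw : 0 ≤ ⟪y + β • H ((2 : ℝ) • z - x) - w, w⟫) :
    0 ≤ α⁻¹ * ⟪x - z, z⟫ - ⟪P (x - z), z⟫ - ⟪H (x - z), w⟫ - ⟪H z, y - w⟫ + β⁻¹ * ⟪y - w, w⟫ := by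
  have hz' := mul_nonneg (inv_pos.2 hα).le hz
  have hw' := mul_nonneg (inv_pos.2 hβ).le hw
  have hPz := hP z
  simp only [inner_sub_left, inner_sub_right, inner_add_left, real_inner_smul_left, map_sub,
    map_smul, hG] at hz' hw' ⊢
  have e1 : α⁻¹ * α = 1 := inv_mul_cancel₀ hα.ne'
  have e2 : β⁻¹ * β = 1 := inv_mul_cancel₀ hβ.ne'
  have e3 : α⁻¹ * (⟪x, z⟫ - α * (⟪P x, z⟫ + ⟪H z, y⟫) - ⟪z, z⟫) =
      α⁻¹ * (⟪x, z⟫ - ⟪z, z⟫) - (⟪P x, z⟫ + ⟪H z, y⟫) := by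
    linear_combination -(⟪P x, z⟫ + ⟪H z, y⟫) * e1
  have e4 : β⁻¹ * (⟪y, w⟫ + β * (2 * ⟪H z, w⟫ - ⟪H x, w⟫) - ⟪w, w⟫) =
      β⁻¹ * (⟪y, w⟫ - ⟪w, w⟫) + (2 * ⟪H z, w⟫ - ⟪H x, w⟫) := by
    linear_combination (2 * ⟪H z, w⟫ - ⟪H x, w⟫) * e2
  linarith

/-- existence of the minimal-displacement limits of the xPIPG iterates,
with `z̄ ∈ rec D` and `w̄ ∈ K°`. -/
theorem stmt6 {n m : ℕ} (P : Matrix (Fin n) (Fin n) ℝ) (q : EuclideanSpace ℝ (Fin n))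
    (H : Matrix (Fin m) (Fin n) ℝ) (g : EuclideanSpace ℝ (Fin m))
    (D : Set (EuclideanSpace ℝ (Fin n))) (K : Set (EuclideanSpace ℝ (Fin m)))
    (hP : P.PosSemidef)
    (hDne : D.Nonempty) (hDcl : IsClosed D) (hDcv : Convex ℝ D)
    (hKne : K.Nonempty) (hK : IsClosedConvexCone K)
    (α β ρ : ℝ) (hα : 0 < α) (hβ : 0 < β)
    (hstep : α * (specNorm P + β * specNorm H ^ 2) < 1)
    (hρ : ρ ∈ Set.Ioo (0 : ℝ) 2)
    (z ξ : ℕ → EuclideanSpace ℝ (Fin n)) (w η : ℕ → EuclideanSpace ℝ (Fin m))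
    (hz : ∀ j, 1 ≤ j → z (j + 1) = proj D (ξ j - α • (mvec P (ξ j) + q + mvec Hᵀ (η j))))
    (hw : ∀ j, 1 ≤ j → w (j + 1) =
      proj (polarCone K) (η j + β • (mvec H ((2 : ℝ) • z (j + 1) - ξ j) - g)))
    (hξ : ∀ j, 1 ≤ j → ξ (j + 1) = (1 - ρ) • ξ j + ρ • z (j + 1))
    (hη : ∀ j, 1 ≤ j → η (j + 1) = (1 - ρ) • η j + ρ • w (j + 1)) :
    ∃ zbar ∈ recCone D, ∃ wbar ∈ polarCone K,
      Tendsto (fun j : ℕ => z (j + 1) - z j) atTop (𝓝 zbar) ∧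
      Tendsto (fun j : ℕ => w (j + 1) - w j) atTop (𝓝 wbar) ∧
      Tendsto (fun j : ℕ => (j : ℝ)⁻¹ • z j) atTop (𝓝 zbar) ∧
      Tendsto (fun j : ℕ => (j : ℝ)⁻¹ • w j) atTop (𝓝 wbar) := by
  have hPpos : (Matrix.toEuclideanLin P).IsPositive := Matrix.isPositive_toEuclideanLin_iff.2 hP
  obtain ⟨L, hLker, hL⟩ := exists_preconditioner_factorization hPpos
    (Matrix.toEuclideanLin H) hα hβ hstep
  have hCne : (polarCone K).Nonempty := ⟨0, zero_mem_polarCone K⟩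
  have hCcl := isClosed_polarCone K
  have hCcv := convex_polarCone K
  obtain ⟨⟨zbar, wbar⟩, hd⟩ := exists_tendsto_sub_of_relaxed_proximal L hLker hρ
    (u := fun n => (ξ (n + 1), η (n + 1))) (v := fun n => (z (n + 2), w (n + 2)))
    (fun n => Prod.ext (hξ (n + 1) (Nat.le_add_left _ _)) (hη (n + 1) (Nat.le_add_left _ _)))
    (fun n m => by
      rw [hL]
      refine primal_dual_step_monotone (G := Matrix.toEuclideanLin Hᵀ) hPpos.2
        (mvec_inner_transpose H) hα hβ ?_ ?_
      · have h := inner_proj_sub_proj_nonneg hDne hDcl hDcv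
          (ξ (n + 1) - α • (mvec P (ξ (n + 1)) + q + mvec Hᵀ (η (n + 1))))
          (ξ (m + 1) - α • (mvec P (ξ (m + 1)) + q + mvec Hᵀ (η (m + 1))))
        rw [← hz (n + 1) (Nat.le_add_left _ _), ← hz (m + 1) (Nat.le_add_left _ _)] at h
        refine h.trans_eq (congrArg₂ _ ?_ rfl)
        simp only [mvec, Prod.fst_sub, Prod.snd_sub, map_sub]
        module
      · have h := inner_proj_sub_proj_nonneg hCne hCcl hCcv
          (η (n + 1) + β • (mvec H ((2 : ℝ) • z (n + 1 + 1) - ξ (n + 1)) - g))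
          (η (m + 1) + β • (mvec H ((2 : ℝ) • z (m + 1 + 1) - ξ (m + 1)) - g))
        rw [← hw (n + 1) (Nat.le_add_left _ _), ← hw (m + 1) (Nat.le_add_left _ _)] at h
        refine h.trans_eq (congrArg₂ _ ?_ rfl)
        simp only [mvec, Prod.fst_sub, Prod.snd_sub, map_sub, map_smul]
        module)
  have hzd : Tendsto (fun j => z (j + 1) - z j) atTop (𝓝 zbar) :=
    (tendsto_add_atTop_iff_nat 2).1 ((continuous_fst.tendsto _).comp hd)
  have hwd : Tendsto (fun j => w (j + 1) - w j) atTop (𝓝 wbar) :=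
    (tendsto_add_atTop_iff_nat 2).1 ((continuous_snd.tendsto _).comp hd)
  have hzj := tendsto_inv_smul_of_tendsto_sub hzd
  have hwj := tendsto_inv_smul_of_tendsto_sub hwd
  have hzmem : ∀ᶠ j in atTop, z j ∈ D := by
    filter_upwards [eventually_ge_atTop 2] with j hj
    obtain ⟨k, rfl⟩ := Nat.exists_eq_add_of_le' hj
    rw [hz (k + 1) (Nat.le_add_left _ _)]
    exact (proj_spec hDne hDcl hDcv _).1
  have hwmem : ∀ᶠ j : ℕ in atTop, (j : ℝ)⁻¹ • w j ∈ polarCone K := by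
    filter_upwards [eventually_ge_atTop 2] with j hj
    obtain ⟨k, rfl⟩ := Nat.exists_eq_add_of_le' hj
    rw [hw (k + 1) (Nat.le_add_left _ _)]
    exact smul_mem_polarCone (proj_spec hCne hCcl hCcv _).1 (by positivity)
  exact ⟨zbar, mem_recCone_of_tendsto hDcl hDcv hzmem hzj, wbar,
    hCcl.mem_of_tendsto hwj hwmem, hzd, hwd, hzj, hwj⟩
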